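/- Let w be a weight on ℝ and let δ > 1. Assume w is an A₁ weight with constant at most δ, i.e., Mw(x) ≤ δ·w(x) for almost every x ∈ ℝ. Then for every bounded interval I of positive length and every measurable set E ⊆ I, one has w(E)/w(I) ≤ δ · (|E|/|I|)^{1/δ}. -/

import Mathlib

open MeasureTheory Set ENNReal

noncomputable section

/-- The non-centered Hardy–Littlewood maximal operator on `ℝ`, as a supremum of
averages over bounded open intervals containing the point. -/
def M1 (f : ℝ → ℝ) (x : ℝ) : ℝ≥0∞ :=
  ⨆ (a : ℝ) (b : ℝ) (_ : a < b) (_ : x ∈ Set.Ioo a b),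
    (∫⁻ y in Set.Ioo a b, ENNReal.ofReal |f y|) / volume (Set.Ioo a b)

/-- A bounded nonempty open preconnected subset of `ℝ` is an open interval. -/
theorem IsPreconnected.eq_Ioo_of_isOpen {C : Set ℝ} (hC : IsPreconnected C) (ho : IsOpen C)
    (hne : C.Nonempty) (hb : BddBelow C) (ha : BddAbove C) : C = Ioo (sInf C) (sSup C) := by
  refine Subset.antisymm ?_ (IsConnected.Ioo_csInf_csSup_subset ⟨hne, hC⟩ hb ha)
  rw [← interior_Icc]
  exact ho.subset_interior_iff.2 (subset_Icc_csInf_csSup hb ha)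

/-- To compare two measures on a bounded open subset of `ℝ`, it suffices to compare them on the
connected components of this set. -/
theorem measure_le_of_forall_component {μ ν : Measure ℝ} {U : Set ℝ} (hU : IsOpen U)
    (hb : BddBelow U) (ha : BddAbove U)
    (h : ∀ c d, c < d → Ioo c d ⊆ U → c ∉ U → d ∉ U → μ (Ioo c d) ≤ ν (Ioo c d)) :
    μ U ≤ ν U := by
  set S : Set (Set ℝ) := connectedComponentIn U '' U
  have hSU : ⋃₀ S = U := by
    refine Subset.antisymm (sUnion_subset ?_) fun x hx =>
      ⟨_, mem_image_of_mem _ hx, mem_connectedComponentIn hx⟩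
    rintro _ ⟨x, -, rfl⟩
    exact connectedComponentIn_subset U x
  have ho : ∀ C ∈ S, IsOpen C := by
    rintro _ ⟨x, -, rfl⟩
    exact hU.connectedComponentIn
  have hne : ∀ C ∈ S, C.Nonempty := by
    rintro _ ⟨x, hx, rfl⟩
    exact ⟨x, mem_connectedComponentIn hx⟩
  have hd : S.Pairwise Disjoint := by
    rintro _ ⟨x, -, rfl⟩ _ ⟨y, -, rfl⟩ hxy
    rw [Set.disjoint_left]
    intro z hzx hzy
    exact hxy ((connectedComponentIn_eq hzx).trans (connectedComponentIn_eq hzy).symm)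
  have hc : S.Countable := Set.PairwiseDisjoint.countable_of_isOpen (s := id) hd ho hne
  rw [← hSU, measure_sUnion hc hd fun C hC => (ho C hC).measurableSet,
    measure_sUnion hc hd fun C hC => (ho C hC).measurableSet]
  refine ENNReal.tsum_le_tsum ?_
  rintro ⟨_, x, hx, rfl⟩
  have hsub := connectedComponentIn_subset U x
  have hmem := mem_connectedComponentIn hx
  have heq := isPreconnected_connectedComponentIn.eq_Ioo_of_isOpen hU.connectedComponentIn
    ⟨x, hmem⟩ (hb.mono hsub) (ha.mono hsub)
  have hmax : ∀ s : Set ℝ, IsPreconnected s → x ∈ s → s ⊆ U → s ⊆ connectedComponentIn U x :=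
    fun s h₁ h₂ h₃ => h₁.subset_connectedComponentIn h₂ h₃
  simp only
  generalize sInf (connectedComponentIn U x) = c at heq
  generalize sSup (connectedComponentIn U x) = d at heq
  rw [heq] at hsub hmem hmax ⊢
  have hcd := hmem.1.trans hmem.2
  refine h c d hcd hsub (fun hcU => ?_) fun hdU => ?_
  · refine lt_irrefl c (hmax (Ico c d) isPreconnected_Ico (Ioo_subset_Ico_self hmem) ?_
      (left_mem_Ico.2 hcd)).1
    rw [← Ioo_insert_left hcd]
    exact insert_subset hcU hsub
  · refine lt_irrefl d (hmax (Ioc c d) isPreconnected_Ioc (Ioo_subset_Ioc_self hmem) ?_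
      (right_mem_Ioc.2 hcd)).2
    rw [← Ioo_insert_right hcd]
    exact insert_subset hdU hsub

theorem isOpen_lt_M1 (f : ℝ → ℝ) (t : ℝ≥0∞) : IsOpen {x | t < M1 f x} := by
  have : {x | t < M1 f x} = ⋃ (a : ℝ) (b : ℝ) (_ : a < b)
      (_ : t < (∫⁻ y in Ioo a b, ENNReal.ofReal |f y|) / volume (Ioo a b)), Ioo a b := by
    ext x
    simp only [M1, lt_iSup_iff, mem_ofPred_eq, mem_iUnion]
    constructor
    · rintro ⟨a, b, hab, hx, ht⟩
      exact ⟨a, b, hab, ht, hx⟩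
    · rintro ⟨a, b, hab, ht, hx⟩
      exact ⟨a, b, hab, hx, ht⟩
  rw [this]
  exact isOpen_iUnion fun a => isOpen_iUnion fun b => isOpen_iUnion fun _ =>
    isOpen_iUnion fun _ => isOpen_Ioo

theorem average_le_M1 (f : ℝ → ℝ) {a b x : ℝ} (hx : x ∈ Ioo a b) :
    (∫⁻ y in Ioo a b, ENNReal.ofReal |f y|) / volume (Ioo a b) ≤ M1 f x :=
  le_iSup_of_le a <| le_iSup_of_le b <| le_iSup_of_le (hx.1.trans hx.2) <|
    le_iSup_of_le hx le_rfl

theorem lintegral_Ioo_le_of_M1_le {f : ℝ → ℝ} {a b x t : ℝ} (ht : 0 ≤ t) (hx : x ∈ Ioo a b)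
    (h : M1 f x ≤ ENNReal.ofReal t) :
    ∫⁻ y in Ioo a b, ENNReal.ofReal |f y| ≤ ENNReal.ofReal (t * (b - a)) := by
  have hab : a < b := hx.1.trans hx.2
  have := (average_le_M1 f hx).trans h
  rw [ENNReal.div_le_iff (by simpa using hab) (by simp), Real.volume_Ioo,
    ← ENNReal.ofReal_mul ht] at this
  exact this

theorem ae_le_M1 {f : ℝ → ℝ} (hf : LocallyIntegrable f volume) (hf0 : ∀ x, 0 ≤ f x) :
    ∀ᵐ x, ENNReal.ofReal (f x) ≤ M1 f x := by
  filter_upwards [IsUnifLocDoublingMeasure.ae_tendsto_average (μ := volume) hf 1] with x hx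
  have hlim := hx (l := nhdsWithin (0 : ℝ) (Ioi 0)) (fun _ => x) id Filter.tendsto_id <| by
    filter_upwards [self_mem_nhdsWithin] with r hr
    simpa using le_of_lt hr
  refine le_of_tendsto (ENNReal.tendsto_ofReal hlim) ?_
  filter_upwards [self_mem_nhdsWithin] with r hr
  have hr : 0 < r := hr
  refine le_trans (le_of_eq ?_) (average_le_M1 f (a := x - r) (b := x + r) (by simp [hr]))
  have hint : IntegrableOn f (Ioo (x - r) (x + r)) :=
    (hf.integrableOn_isCompact isCompact_Icc).mono_set Ioo_subset_Icc_self
  simp only [id, Real.closedBall_eq_Icc, setAverage_eq, abs_of_nonneg (hf0 _)]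
  rw [← ofReal_integral_eq_lintegral_ofReal hint (Filter.Eventually.of_forall hf0),
    integral_Icc_eq_integral_Ioo, Real.volume_Ioo, ← ENNReal.ofReal_div_of_pos (by linarith),
    Real.volume_real_Icc_of_le (by linarith), smul_eq_mul, inv_mul_eq_div]

/-- On the part of an interval where the maximal function exceeds a level `t` which is at least
the average over the interval, the mean of `f` is at most `t`. -/
theorem lintegral_lt_M1_le {f : ℝ → ℝ} {a b t : ℝ} (ht : 0 ≤ t)
    (hI : ∫⁻ y in Ioo a b, ENNReal.ofReal |f y| ≤ ENNReal.ofReal (t * (b - a))) :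
    ∫⁻ y in {x | ENNReal.ofReal t < M1 f x} ∩ Ioo a b, ENNReal.ofReal |f y| ≤
      ENNReal.ofReal t * volume ({x | ENNReal.ofReal t < M1 f x} ∩ Ioo a b) := by
  set U := {x | ENNReal.ofReal t < M1 f x} ∩ Ioo a b
  have hU : IsOpen U := (isOpen_lt_M1 f _).inter isOpen_Ioo
  have key := measure_le_of_forall_component (U := U)
    (μ := volume.withDensity fun y => ENNReal.ofReal |f y|) (ν := ENNReal.ofReal t • volume) hU
    (bddBelow_Ioo.mono inter_subset_right) (bddAbove_Ioo.mono inter_subset_right) ?_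
  · rwa [withDensity_apply _ hU.measurableSet, Measure.smul_apply, smul_eq_mul] at key
  intro c d hcd hsub hc hd
  rw [withDensity_apply _ measurableSet_Ioo, Measure.smul_apply, smul_eq_mul, Real.volume_Ioo,
    ← ENNReal.ofReal_mul ht]
  obtain ⟨hac, hdb⟩ := (Ioo_subset_Ioo_iff hcd).1 (hsub.trans inter_subset_right)
  have hlim : ∀ s : ℝ → Set ℝ, (∀ ε > 0, Ioo c d ⊆ s ε ∧
      ∫⁻ y in s ε, ENNReal.ofReal |f y| ≤ ENNReal.ofReal (t * (d - c + ε))) →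
      ∫⁻ y in Ioo c d, ENNReal.ofReal |f y| ≤ ENNReal.ofReal (t * (d - c)) := by
    intro s hs
    have : Filter.Tendsto (fun ε : ℝ => ENNReal.ofReal (t * (d - c + ε)))
        (nhdsWithin 0 (Ioi 0)) (nhds (ENNReal.ofReal (t * (d - c)))) := by
      refine Filter.Tendsto.mono_left ?_ nhdsWithin_le_nhds
      have h : Continuous fun ε : ℝ => ENNReal.ofReal (t * (d - c + ε)) :=
        ENNReal.continuous_ofReal.comp (by fun_prop)
      simpa using h.tendsto 0
    refine ge_of_tendsto this ?_
    filter_upwards [self_mem_nhdsWithin] with ε hε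
    exact (lintegral_mono_set (hs ε hε).1).trans (hs ε hε).2
  by_cases hc' : a < c
  · have hcM : M1 f c ≤ ENNReal.ofReal t := by
      by_contra! h
      exact hc ⟨h, hc', hcd.trans_le hdb⟩
    refine hlim (fun ε => Ioo (c - ε) d) fun ε hε => ⟨Ioo_subset_Ioo_left (by linarith), ?_⟩
    refine (lintegral_Ioo_le_of_M1_le ht ⟨by linarith, hcd⟩ hcM).trans_eq ?_
    congr 1
    ring
  by_cases hd' : d < b
  · have hdM : M1 f d ≤ ENNReal.ofReal t := by
      by_contra! h
      exact hd ⟨h, hac.trans_lt hcd, hd'⟩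
    refine hlim (fun ε => Ioo c (d + ε)) fun ε hε => ⟨Ioo_subset_Ioo_right (by linarith), ?_⟩
    refine (lintegral_Ioo_le_of_M1_le ht ⟨hcd, by linarith⟩ hdM).trans_eq ?_
    congr 1
    ring
  obtain rfl : a = c := le_antisymm hac (not_lt.1 hc')
  obtain rfl : d = b := le_antisymm hdb (not_lt.1 hd')
  exact hI

/-- The integral of `f` minus the level `t` over the set where the maximal function exceeds `t`
is nonpositive, provided that `t` is at least the average of `f`. -/
theorem integral_indicator_lt_M1_nonpos {f : ℝ → ℝ} (hf0 : ∀ x, 0 ≤ f x) {a b t : ℝ}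
    (hf : IntegrableOn f (Ioo a b)) (ht : 0 ≤ t)
    (hI : ∫ y in Ioo a b, f y ≤ t * (b - a)) :
    ∫ x in Ioo a b, {x | ENNReal.ofReal t < M1 f x}.indicator (fun x => f x - t) x ≤ 0 := by
  have hU : MeasurableSet {x | ENNReal.ofReal t < M1 f x} := (isOpen_lt_M1 f _).measurableSet
  have key := lintegral_lt_M1_le (f := f) (a := a) (b := b) ht (by
    simp only [abs_of_nonneg (hf0 _)]
    rw [← ofReal_integral_eq_lintegral_ofReal hf (Filter.Eventually.of_forall hf0)]
    exact ENNReal.ofReal_le_ofReal hI)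
  rw [setIntegral_indicator hU, inter_comm (Ioo a b)]
  set V := {x | ENNReal.ofReal t < M1 f x} ∩ Ioo a b
  have hV : volume V ≠ ⊤ := ((measure_mono inter_subset_right).trans_lt measure_Ioo_lt_top).ne
  have hfV : IntegrableOn f V := hf.mono_set inter_subset_right
  simp only [abs_of_nonneg (hf0 _)] at key
  rw [← ofReal_integral_eq_lintegral_ofReal hfV (Filter.Eventually.of_forall hf0),
    ← ENNReal.ofReal_toReal hV, ← ENNReal.ofReal_mul ht,
    ENNReal.ofReal_le_ofReal_iff (by positivity)] at key
  rw [integral_sub hfV (integrableOn_const hV), setIntegral_const, smul_eq_mul, Measure.real]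
  linarith

theorem integrableOn_max_sub {f : ℝ → ℝ} {s : Set ℝ} (hf : IntegrableOn f s)
    (hs : volume s ≠ ⊤) (t : ℝ) : IntegrableOn (fun x => max (f x - t) 0) s :=
  (hf.sub (integrableOn_const hs)).pos_part

/-- The excess of an `A₁` weight over a level decays quantitatively when the level increases. -/
theorem mul_integral_excess_le {w : ℝ → ℝ} (hw : ∀ x, 0 ≤ w x)
    (hloc : LocallyIntegrable w volume) {δ : ℝ} (hδ : 1 < δ)
    (hA1 : ∀ᵐ x : ℝ ∂volume, M1 w x ≤ ENNReal.ofReal (δ * w x))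
    {a b s t : ℝ} (hs : 0 < s) (hst : s ≤ t)
    (hI : ∫ y in Ioo a b, w y ≤ δ * t * (b - a)) :
    (1 + (δ - 1)⁻¹ * (1 - s / t)) * ∫ x in Ioo a b, max (w x - t) 0 ≤
      ∫ x in Ioo a b, max (w x - s) 0 := by
  have hint : IntegrableOn w (Ioo a b) :=
    (hloc.integrableOn_isCompact isCompact_Icc).mono_set Ioo_subset_Icc_self
  have hfin : volume (Ioo a b) ≠ ⊤ := measure_Ioo_lt_top.ne
  have ht : 0 < t := hs.trans_le hst
  have hδt : 0 ≤ δ * t := by positivity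
  set k := (δ - 1)⁻¹ * (1 - s / t) with hk
  have hk0 : 0 ≤ k := mul_nonneg (inv_nonneg.2 (by linarith))
    (sub_nonneg.2 ((div_le_one ht).2 hst))
  have hkt : k * (δ * t - t) = t - s := by
    have : δ - 1 ≠ 0 := by linarith
    rw [hk]
    field_simp
  set U := {x | ENNReal.ofReal (δ * t) < M1 w x}
  have hU : MeasurableSet U := (isOpen_lt_M1 w _).measurableSet
  have hUint : IntegrableOn (U.indicator fun x => w x - δ * t) (Ioo a b) :=
    (hint.sub (integrableOn_const hfin)).indicator hU
  have hle : ∫ x in Ioo a b, (1 + k) * max (w x - t) 0 ≤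
      ∫ x in Ioo a b, (max (w x - s) 0 + k * U.indicator (fun x => w x - δ * t) x) := by
    refine integral_mono_ae ((integrableOn_max_sub hint hfin t).const_mul _)
      ((integrableOn_max_sub hint hfin s).add (hUint.const_mul k)) (ae_restrict_of_ae ?_)
    filter_upwards [hA1, ae_le_M1 hloc hw] with x hx₁ hx₂
    by_cases hxU : x ∈ U
    · have hlt : δ * t < δ * w x := ((ENNReal.ofReal_lt_ofReal_iff_of_nonneg hδt).1
        (lt_of_lt_of_le hxU hx₁))
      have hlt : t < w x := lt_of_mul_lt_mul_left hlt (by linarith)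
      simp only [indicator_of_mem hxU]
      rw [max_eq_left (by linarith), max_eq_left (by linarith)]
      linarith
    · have hwle : w x ≤ δ * t :=
        (ENNReal.ofReal_le_ofReal_iff hδt).1 (hx₂.trans (not_lt.1 hxU))
      simp only [indicator_of_notMem hxU]
      rcases le_total (w x) t with h | h
      · rw [max_eq_right (by linarith)]
        simp
      · rw [max_eq_left (by linarith), max_eq_left (by linarith)]
        nlinarith
  rw [integral_const_mul, integral_add (integrableOn_max_sub hint hfin s) (hUint.const_mul k),
    integral_const_mul] at hle
  have := integral_indicator_lt_M1_nonpos hw hint hδt hI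
  have := mul_nonpos_of_nonneg_of_nonpos hk0 this
  linarith

/-- A discrete form of Grönwall's inequality on a multiplicative scale. -/
theorem mul_exp_le_of_forall_le {F : ℝ → ℝ} {κ s₀ T : ℝ} (hκ : 0 ≤ κ) (hs₀ : 0 < s₀)
    (hT : 0 ≤ T) (h : ∀ s t, s₀ ≤ s → s ≤ t → (1 + κ * (1 - s / t)) * F t ≤ F s) :
    Real.exp (κ * T) * F (s₀ * Real.exp T) ≤ F s₀ := by
  have hstep : ∀ r : ℝ, 0 ≤ r → ∀ n : ℕ,
      (1 + κ * (1 - Real.exp (-r))) ^ n * F (s₀ * Real.exp (n * r)) ≤ F s₀ := by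
    intro r hr n
    have hbase : 0 ≤ 1 + κ * (1 - Real.exp (-r)) := by
      have : Real.exp (-r) ≤ 1 := Real.exp_le_one_iff.2 (by linarith)
      have := mul_nonneg hκ (sub_nonneg.2 this)
      linarith
    induction n with
    | zero => simp
    | succ n ih =>
      refine le_trans ?_ ih
      rw [pow_succ, mul_assoc]
      refine mul_le_mul_of_nonneg_left ?_ (pow_nonneg hbase n)
      have hdiv : s₀ * Real.exp (n * r) / (s₀ * Real.exp ((n + 1 : ℕ) * r)) = Real.exp (-r) := by
        rw [mul_div_mul_left _ _ hs₀.ne', ← Real.exp_sub]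
        congr 1
        push_cast
        ring
      rw [← hdiv]
      refine h _ _ (le_mul_of_one_le_right hs₀.le (Real.one_le_exp (by positivity))) ?_
      gcongr
      simp
  have hlim : Filter.Tendsto (fun n : ℕ => (1 + κ * (1 - Real.exp (-(T / n)))) ^ n)
      Filter.atTop (nhds (Real.exp (κ * T))) := by
    refine Real.tendsto_one_add_pow_exp_of_tendsto ?_
    have hd : HasDerivAt (fun x : ℝ => κ * (1 - Real.exp (-(T * x)))) (κ * T) 0 := by
      have := ((((hasDerivAt_id (0 : ℝ)).const_mul T).neg.exp).const_sub 1).const_mul κ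
      simpa using this
    have := hd.tendsto_slope_zero_right.comp
      (tendsto_inv_atTop_nhdsGT_zero.comp tendsto_natCast_atTop_atTop)
    simpa [Function.comp_def, div_eq_mul_inv] using this
  refine le_of_tendsto (hlim.mul_const (F (s₀ * Real.exp T))) ?_
  filter_upwards [Filter.eventually_gt_atTop 0] with n hn
  have hn' : (n : ℝ) ≠ 0 := by positivity
  have := hstep (T / n) (by positivity) n
  rwa [mul_div_cancel₀ _ hn'] at this

/-- The sharp form, with constant one, of the power estimate for `A₁` weights. -/
theorem setIntegral_le_mul_rpow {w : ℝ → ℝ} (hw : ∀ x, 0 ≤ w x)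
    (hloc : LocallyIntegrable w volume) {δ : ℝ} (hδ : 1 < δ)
    (hA1 : ∀ᵐ x : ℝ ∂volume, M1 w x ≤ ENNReal.ofReal (δ * w x))
    {a b : ℝ} (hab : a < b) {E : Set ℝ} (hEI : E ⊆ Ioo a b)
    (hW : 0 < ∫ x in Ioo a b, w x) (hE : 0 < volume.real E) :
    ∫ x in E, w x ≤ (∫ x in Ioo a b, w x) * (volume.real E / (b - a)) ^ (1 / δ) := by
  have hint : IntegrableOn w (Ioo a b) :=
    (hloc.integrableOn_isCompact isCompact_Icc).mono_set Ioo_subset_Icc_self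
  have hfin : volume (Ioo a b) ≠ ⊤ := measure_Ioo_lt_top.ne
  have hEfin : volume E ≠ ⊤ := ((measure_mono hEI).trans_lt measure_Ioo_lt_top).ne
  have hL : 0 < b - a := sub_pos.2 hab
  have hδ0 : 0 < δ := by linarith
  have hδ1 : 0 < δ - 1 := by linarith
  set W := ∫ x in Ioo a b, w x with hWdef
  set e := volume.real E / (b - a) with he
  have he0 : 0 < e := by positivity
  have he1 : e ≤ 1 := by
    rw [he, div_le_one hL, ← Real.volume_real_Ioo_of_le hab.le]
    exact measureReal_mono hEI hfin
  set s₀ := W / (δ * (b - a)) with hs₀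
  have hs₀pos : 0 < s₀ := by positivity
  have hδs₀ : δ * s₀ * (b - a) = W := by
    rw [hs₀]
    field_simp
  have hlow : ∀ᵐ x ∂volume.restrict (Ioo a b), s₀ ≤ w x := by
    filter_upwards [ae_restrict_of_ae hA1, ae_restrict_mem measurableSet_Ioo] with x hx hxI
    have h := lintegral_Ioo_le_of_M1_le (mul_nonneg hδ0.le (hw x)) hxI hx
    simp only [abs_of_nonneg (hw _)] at h
    rw [← ofReal_integral_eq_lintegral_ofReal hint (Filter.Eventually.of_forall hw),
      ENNReal.ofReal_le_ofReal_iff (by have := hw x; positivity), ← hWdef, ← hδs₀] at h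
    exact le_of_mul_le_mul_left (le_of_mul_le_mul_right h hL) hδ0
  have hH₀ : ∫ x in Ioo a b, max (w x - s₀) 0 = W * (1 - 1 / δ) := by
    have : ∫ x in Ioo a b, max (w x - s₀) 0 = ∫ x in Ioo a b, (w x - s₀) := by
      refine integral_congr_ae ?_
      filter_upwards [hlow] with x hx
      exact max_eq_left (sub_nonneg.2 hx)
    rw [this, integral_sub hint (integrableOn_const hfin), setIntegral_const,
      Real.volume_real_Ioo_of_le hab.le, smul_eq_mul, ← hWdef, hs₀]
    field_simp
  set T := -((δ - 1) / δ * Real.log e) with hT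
  have hT0 : 0 ≤ T := by
    have := mul_nonpos_of_nonneg_of_nonpos (div_nonneg hδ1.le hδ0.le)
      (Real.log_nonpos he0.le he1)
    linarith
  have hdecay := mul_exp_le_of_forall_le
    (F := fun t => ∫ x in Ioo a b, max (w x - t) 0) (inv_nonneg.2 hδ1.le) hs₀pos hT0
    fun s t hs hst => mul_integral_excess_le hw hloc hδ hA1 (hs₀pos.trans_le hs) hst (by
      rw [← hWdef, ← hδs₀]
      have := hs.trans hst
      gcongr)
  simp only [hH₀] at hdecay
  set t := s₀ * Real.exp T with ht
  have hexp : Real.exp ((δ - 1)⁻¹ * T) * e ^ (1 / δ) = 1 := by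
    rw [Real.rpow_def_of_pos he0, ← Real.exp_add, Real.exp_eq_one_iff, hT]
    field_simp
    ring
  have hepow : 0 < e ^ (1 / δ) := by positivity
  have hHt : ∫ x in Ioo a b, max (w x - t) 0 ≤ W * (1 - 1 / δ) * e ^ (1 / δ) := by
    calc ∫ x in Ioo a b, max (w x - t) 0
        = (Real.exp ((δ - 1)⁻¹ * T) * ∫ x in Ioo a b, max (w x - t) 0) * e ^ (1 / δ) := by
          rw [mul_right_comm, hexp, one_mul]
      _ ≤ _ := mul_le_mul_of_nonneg_right hdecay hepow.le
  have htE : t * volume.real E = W * (1 / δ) * e ^ (1 / δ) := by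
    have h₁ : Real.exp T * e = e ^ (1 / δ) := by
      conv_lhs => rw [← Real.exp_log he0]
      rw [Real.rpow_def_of_pos he0, ← Real.exp_add, hT]
      congr 1
      field_simp
      ring
    have h₂ : volume.real E = e * (b - a) := by
      rw [he]
      field_simp
    rw [← h₁, h₂, ht, hs₀]
    field_simp
  have hmaxE := integrableOn_max_sub hint hfin t
  calc ∫ x in E, w x ≤ ∫ x in E, (t + max (w x - t) 0) := by
        refine integral_mono (hint.mono_set hEI)
          ((integrableOn_const hEfin).add (hmaxE.mono_set hEI)) fun x => ?_
        have := le_max_left (w x - t) 0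
        simp only
        linarith
    _ = t * volume.real E + ∫ x in E, max (w x - t) 0 := by
        have hconst : IntegrableOn (fun _ => t) E := integrableOn_const hEfin
        rw [integral_add hconst (hmaxE.mono_set hEI), setIntegral_const, smul_eq_mul, mul_comm]
    _ ≤ t * volume.real E + ∫ x in Ioo a b, max (w x - t) 0 := by
        refine add_le_add le_rfl ?_
        exact setIntegral_mono_set hmaxE (Filter.Eventually.of_forall fun x => le_max_right _ _)
          hEI.eventuallyLE
    _ ≤ W * (1 / δ) * e ^ (1 / δ) + W * (1 - 1 / δ) * e ^ (1 / δ) := by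
        rw [htE]
        gcongr
    _ = W * e ^ (1 / δ) := by ring

/-- Sharp `A∞`-type measure estimate for `A₁` weights on `ℝ`:
if `Mw ≤ δ w` a.e. then `w(E)/w(I) ≤ δ (|E|/|I|)^{1/δ}` for all measurable
`E ⊆ I`. -/
theorem stmt14 (w : ℝ → ℝ) (hw : ∀ x, 0 ≤ w x) (hloc : LocallyIntegrable w volume)
    (δ : ℝ) (hδ : 1 < δ)
    (hA1 : ∀ᵐ x : ℝ ∂volume, M1 w x ≤ ENNReal.ofReal (δ * w x))
    (a b : ℝ) (hab : a < b) (E : Set ℝ) (hE : MeasurableSet E)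
    (hEI : E ⊆ Set.Ioo a b) :
    (∫⁻ x in E, ENNReal.ofReal (w x)) / (∫⁻ x in Set.Ioo a b, ENNReal.ofReal (w x)) ≤
      ENNReal.ofReal δ * (volume E / volume (Set.Ioo a b)) ^ (1 / δ) := by
  have hint : IntegrableOn w (Ioo a b) :=
    (hloc.integrableOn_isCompact isCompact_Icc).mono_set Ioo_subset_Icc_self
  have hEfin : volume E ≠ ⊤ := ((measure_mono hEI).trans_lt measure_Ioo_lt_top).ne
  rcases eq_or_ne (volume E) 0 with hE0 | hE0
  · rw [setLIntegral_measure_zero _ _ hE0, ENNReal.zero_div]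
    exact zero_le
  have hL : 0 < b - a := sub_pos.2 hab
  have hEpos : 0 < volume.real E := ENNReal.toReal_pos hE0 hEfin
  rw [← ofReal_integral_eq_lintegral_ofReal hint (Filter.Eventually.of_forall hw),
    ← ofReal_integral_eq_lintegral_ofReal (hint.mono_set hEI) (Filter.Eventually.of_forall hw)]
  have hEI' : ∫ x in E, w x ≤ ∫ x in Ioo a b, w x :=
    setIntegral_mono_set hint (Filter.Eventually.of_forall hw) hEI.eventuallyLE
  rcases (integral_nonneg hw : 0 ≤ ∫ x in Ioo a b, w x).eq_or_lt with hW | hW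
  · rw [ENNReal.ofReal_of_nonpos (hEI'.trans hW.ge), ENNReal.zero_div]
    exact zero_le
  have key := setIntegral_le_mul_rpow hw hloc hδ hA1 hab hEI hW hEpos
  rw [← ofReal_measureReal hEfin, Real.volume_Ioo, ← ENNReal.ofReal_div_of_pos hL,
    ← ENNReal.ofReal_div_of_pos hW, ENNReal.ofReal_rpow_of_pos (div_pos hEpos hL),
    ← ENNReal.ofReal_mul (by linarith)]
  refine ENNReal.ofReal_le_ofReal ?_
  rw [div_le_iff₀' hW]
  refine key.trans (mul_le_mul_of_nonneg_left ?_ hW.le)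
  exact le_mul_of_one_le_left (by positivity) hδ.le
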